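/- arXiv:cs/0307057 — 12 statements merged into one kernel-verified Lean document; each statement's English description precedes it below -/
import Mathlib

section
/- Let R be a system and C an i-allowability function on R. Then agent j maintains C-secrecy with respect to agent i in R if and only if, for every j-local set S of points and every point (r,m): if S ∩ C(r,m) ≠ ∅, then K_i(r,m) ∩ S ≠ ∅. (This is the semantic form of the paper's syntactic characterization: j maintains C-secrecy with respect to i iff for every interpretation and every j-local formula φ satisfied at some point of C(r,m), the formula P_i φ holds at (r,m).) -/
namespace Paper

variable {G LI LJ : Type*}

/-- The set of points of the system `R`: pairs of a run in `R` and a time. -/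
def ptsOf (R : Set (ℕ → G)) : Set ((ℕ → G) × ℕ) := {p | p.1 ∈ R}

/-- The information set, at the point `p`, of the agent whose local-state projection is `v`:
all points of the system at which the agent has the same local state as at `p`. -/
def infoSet {L : Type*} (R : Set (ℕ → G)) (v : (ℕ → G) → ℕ → L) (p : (ℕ → G) × ℕ) :
    Set ((ℕ → G) × ℕ) :=
  {q | q.1 ∈ R ∧ v q.1 q.2 = v p.1 p.2}

/-- A set `S` of points is local for the agent with local-state projection `v`:
`S ⊆ PT(R)` and membership in `S` depends only on the agent's local state. -/
def IsLocalSet {L : Type*} (R : Set (ℕ → G)) (v : (ℕ → G) → ℕ → L)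
    (S : Set ((ℕ → G) × ℕ)) : Prop :=
  S ⊆ ptsOf R ∧ ∀ p q : (ℕ → G) × ℕ, p ∈ ptsOf R → q ∈ ptsOf R →
    v p.1 p.2 = v q.1 q.2 → (p ∈ S ↔ q ∈ S)

/-- `C` is an allowability function for the agent with local-state projection `vi`:
it maps points to sets of points containing the agent's information set. -/
def IsAllowability (R : Set (ℕ → G)) (vi : (ℕ → G) → ℕ → LI)
    (C : (ℕ → G) × ℕ → Set ((ℕ → G) × ℕ)) : Prop :=
  ∀ p ∈ ptsOf R, C p ⊆ ptsOf R ∧ infoSet R vi p ⊆ C p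

/-- Agent `j` (local states `vj`) maintains `C`-secrecy with respect to agent `i`
(local states `vi`). -/
def CSecrecy (R : Set (ℕ → G)) (vi : (ℕ → G) → ℕ → LI) (vj : (ℕ → G) → ℕ → LJ)
    (C : (ℕ → G) × ℕ → Set ((ℕ → G) × ℕ)) : Prop :=
  ∀ p ∈ ptsOf R, ∀ q ∈ C p, (infoSet R vi p ∩ infoSet R vj q).Nonempty

/-- `j` maintains `C`-secrecy with respect to `i` iff for every `j`-local set `S`
of points and every point `(r,m)`, if `S ∩ C(r,m) ≠ ∅` then `K_i(r,m) ∩ S ≠ ∅`. -/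
theorem cSecrecy_iff_jLocal (R : Set (ℕ → G)) (hR : R.Nonempty)
    (vi : (ℕ → G) → ℕ → LI) (vj : (ℕ → G) → ℕ → LJ)
    (C : (ℕ → G) × ℕ → Set ((ℕ → G) × ℕ)) (hC : IsAllowability R vi C) :
    CSecrecy R vi vj C ↔
      ∀ S : Set ((ℕ → G) × ℕ), IsLocalSet R vj S →
        ∀ p ∈ ptsOf R, (S ∩ C p).Nonempty → (infoSet R vi p ∩ S).Nonempty := by
  constructor
  · rintro h S ⟨hSR, hS⟩ p hp ⟨q, hqS, hqC⟩
    obtain ⟨x, hxi, hxj⟩ := h p hp q hqC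
    exact ⟨x, hxi, (hS x q hxj.1 (hSR hqS) hxj.2).2 hqS⟩
  · intro h p hp q hq
    refine h (infoSet R vj q) ⟨fun x hx => hx.1, fun x y hx hy hxy => ?_⟩ p hp
      ⟨q, ⟨(hC p hp).1 hq, rfl⟩, hq⟩
    exact ⟨fun hxq => ⟨hy, hxy.symm.trans hxq.2⟩, fun hyq => ⟨hx, hxy.trans hyq.2⟩⟩

end Paper
end

section
/- Agent j maintains total secrecy with respect to agent i in the system R if and only if, for every nonempty j-local set S of points and every point (r,m), K_i(r,m) ∩ S ≠ ∅. -/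
namespace Paper

variable {G LI LJ : Type*}

/-- Agent `j` (local states `vj`) maintains total secrecy with respect to agent `i`
(local states `vi`): every `i`-information set meets every `j`-information set. -/
def TotalSecrecy (R : Set (ℕ → G)) (vi : (ℕ → G) → ℕ → LI) (vj : (ℕ → G) → ℕ → LJ) : Prop :=
  ∀ p ∈ ptsOf R, ∀ q ∈ ptsOf R, (infoSet R vi p ∩ infoSet R vj q).Nonempty

theorem mem_infoSet_self {L : Type*} {R : Set (ℕ → G)} (v : (ℕ → G) → ℕ → L)
    {p : (ℕ → G) × ℕ} (hp : p ∈ ptsOf R) : p ∈ infoSet R v p :=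
  ⟨hp, rfl⟩

theorem isLocalSet_infoSet {L : Type*} (R : Set (ℕ → G)) (v : (ℕ → G) → ℕ → L)
    (p : (ℕ → G) × ℕ) : IsLocalSet R v (infoSet R v p) :=
  ⟨fun _ hq => hq.1, fun _ _ ha hb hab =>
    ⟨fun h => ⟨hb, hab.symm.trans h.2⟩, fun h => ⟨ha, hab.trans h.2⟩⟩⟩

theorem IsLocalSet.infoSet_subset {L : Type*} {R : Set (ℕ → G)} {v : (ℕ → G) → ℕ → L}
    {S : Set ((ℕ → G) × ℕ)} (hS : IsLocalSet R v S) {p : (ℕ → G) × ℕ} (hp : p ∈ S) :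
    infoSet R v p ⊆ S :=
  fun q hq => (hS.2 q p hq.1 (hS.1 hp) hq.2).2 hp

/-- `j` maintains total secrecy with respect to `i` in `R` iff for every
nonempty `j`-local set `S` of points and every point `(r,m)`, `K_i(r,m) ∩ S ≠ ∅`. -/
theorem totalSecrecy_iff_jLocal (R : Set (ℕ → G)) (hR : R.Nonempty)
    (vi : (ℕ → G) → ℕ → LI) (vj : (ℕ → G) → ℕ → LJ) :
    TotalSecrecy R vi vj ↔
      ∀ S : Set ((ℕ → G) × ℕ), IsLocalSet R vj S → S.Nonempty →
        ∀ p ∈ ptsOf R, (infoSet R vi p ∩ S).Nonempty := by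
  constructor
  · rintro h S hS ⟨q, hq⟩ p hp
    exact (h p hp q (hS.1 hq)).mono (Set.inter_subset_inter_right _ (hS.infoSet_subset hq))
  · intro h p hp q hq
    exact h _ (isLocalSet_infoSet R vj q) ⟨q, mem_infoSet_self vj hq⟩ p hp

end Paper
end

section
/- Agent j maintains run-based secrecy with respect to agent i in the system R if and only if, for every nonempty j-local set S of points and every point (r,m), R(K_i(r,m)) ∩ R(S) ≠ ∅ (i.e., some run passing through a point of K_i(r,m) also passes through a point of S). (This is the semantic form of: for every interpretation and every satisfiable j-local formula φ, the formula P_i ⟐φ is valid.) -/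
namespace Paper

variable {G LI LJ : Type*}

/-- `R(U)`: the runs of `R` going through a point of `U`. -/
def runsThrough (R : Set (ℕ → G)) (U : Set ((ℕ → G) × ℕ)) : Set (ℕ → G) :=
  {r | r ∈ R ∧ ∃ m : ℕ, (r, m) ∈ U}

/-- Agent `j` (local states `vj`) maintains run-based secrecy with respect to agent `i`
(local states `vi`). -/
def RunBasedSecrecy (R : Set (ℕ → G)) (vi : (ℕ → G) → ℕ → LI)
    (vj : (ℕ → G) → ℕ → LJ) : Prop :=
  ∀ p ∈ ptsOf R, ∀ q ∈ ptsOf R,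
    (runsThrough R (infoSet R vi p) ∩ runsThrough R (infoSet R vj q)).Nonempty

theorem runsThrough_mono (R : Set (ℕ → G)) {U V : Set ((ℕ → G) × ℕ)} (h : U ⊆ V) :
    runsThrough R U ⊆ runsThrough R V :=
  fun _ ⟨hr, m, hm⟩ => ⟨hr, m, h hm⟩

/-- `j` maintains run-based secrecy with respect to `i` in `R` iff for every
nonempty `j`-local set `S` of points and every point `(r,m)`,
`R(K_i(r,m)) ∩ R(S) ≠ ∅`. -/
theorem runBasedSecrecy_iff_jLocal (R : Set (ℕ → G)) (hR : R.Nonempty)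
    (vi : (ℕ → G) → ℕ → LI) (vj : (ℕ → G) → ℕ → LJ) :
    RunBasedSecrecy R vi vj ↔
      ∀ S : Set ((ℕ → G) × ℕ), IsLocalSet R vj S → S.Nonempty →
        ∀ p ∈ ptsOf R, (runsThrough R (infoSet R vi p) ∩ runsThrough R S).Nonempty := by
  constructor
  · rintro h S hS ⟨q, hq⟩ p hp
    exact (h p hp q (hS.1 hq)).mono
      (Set.inter_subset_inter_right _ (runsThrough_mono R (hS.infoSet_subset hq)))
  · intro h p hp q hq
    exact h _ (isLocalSet_infoSet R vj q) ⟨q, mem_infoSet_self vj hq⟩ p hp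

end Paper
end

section
/- If R is a system in which agents i and j both have perfect recall, C is an i-allowability function that depends only on timing, and agent j maintains C-secrecy with respect to i, then agent j maintains run-based secrecy with respect to i. -/
namespace Paper

variable {G LI LJ : Type*}

/-- The local-state sequence of the agent with local-state projection `v` at the point
`(r,m)`: the sequence `⟨v r 0, …, v r m⟩` with consecutive repetitions deleted. -/
noncomputable def lsSeq {L : Type*} (v : (ℕ → G) → ℕ → L) (r : ℕ → G) (m : ℕ) : List L :=
  letI : DecidableRel fun a b : L => a ≠ b := fun _ _ => Classical.dec _
  ((List.range (m + 1)).map (v r)).destutter (· ≠ ·)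

/-- The agent with local-state projection `v` has perfect recall in `R`. -/
def PerfectRecall {L : Type*} (R : Set (ℕ → G)) (v : (ℕ → G) → ℕ → L) : Prop :=
  ∀ p q : (ℕ → G) × ℕ, p ∈ ptsOf R → q ∈ infoSet R v p →
    lsSeq v q.1 q.2 = lsSeq v p.1 p.2

/-- The allowability function `C` depends only on timing. -/
def DependsOnTiming (R : Set (ℕ → G)) (C : (ℕ → G) × ℕ → Set ((ℕ → G) × ℕ)) : Prop :=
  (∀ r ∈ R, ∀ r' ∈ R, ∀ m' : ℕ, ∃ m : ℕ, (r', m') ∈ C (r, m)) ∧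
  (∀ r r' : ℕ → G, ∀ m m' n : ℕ, (r', m') ∈ C (r, m) → m ≤ n →
    ∃ n' : ℕ, m' ≤ n' ∧ (r', n') ∈ C (r, n)) ∧
  (∀ r r' : ℕ → G, ∀ m m' n : ℕ, (r', m') ∈ C (r, m) → n ≤ m →
    ∃ n' : ℕ, n' ≤ m' ∧ (r', n') ∈ C (r, n)) ∧
  (∀ r r' : ℕ → G, ∀ m n₁ n₂ m' : ℕ, (r', n₁) ∈ C (r, m) → (r', n₂) ∈ C (r, m) →
    n₁ ≤ m' → m' ≤ n₂ → (r', m') ∈ C (r, m))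

theorem mem_destutter'_ne {α : Type*} [DecidableRel fun a b : α => a ≠ b] (l : List α)
    {a x : α} : x ∈ l.destutter' (· ≠ ·) a ↔ x ∈ a :: l := by
  induction l generalizing a with
  | nil => simp
  | cons b l ih =>
    rw [List.destutter'_cons]
    split_ifs with h
    · simp [ih]
    · obtain rfl : a = b := not_not.mp h
      simp [ih]

theorem mem_lsSeq {L : Type*} {v : (ℕ → G) → ℕ → L} {r : ℕ → G} {m : ℕ} {x : L} :
    x ∈ lsSeq v r m ↔ ∃ k ≤ m, v r k = x := by
  have mem_destutter_ne (l : List L) [DecidableRel fun a b : L => a ≠ b] :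
      x ∈ l.destutter (· ≠ ·) ↔ x ∈ l := by
    cases l with
    | nil => simp
    | cons a l => rw [List.destutter_cons', mem_destutter'_ne]
  simp [lsSeq, mem_destutter_ne]

/-- Under perfect recall, a run through the information set at `(r, n)` also goes through the
information set at every earlier point `(r, m)`. -/
theorem PerfectRecall.runsThrough_infoSet_subset {L : Type*} {R : Set (ℕ → G)}
    {v : (ℕ → G) → ℕ → L} (hv : PerfectRecall R v) {r : ℕ → G} (hr : r ∈ R) {m n : ℕ}
    (hmn : m ≤ n) :
    runsThrough R (infoSet R v (r, n)) ⊆ runsThrough R (infoSet R v (r, m)) := by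
  rintro s ⟨hs, k, hk⟩
  have hmem : v r m ∈ lsSeq v s k := by
    rw [hv (r, n) (s, k) hr hk]
    exact mem_lsSeq.mpr ⟨m, hmn, rfl⟩
  obtain ⟨k', -, hk'⟩ := mem_lsSeq.mp hmem
  exact ⟨hs, k', hs, hk'⟩

/-- if both agents have perfect recall, `C` is an `i`-allowability function
depending only on timing, and `j` maintains `C`-secrecy with respect to `i`, then `j`
maintains run-based secrecy with respect to `i`. -/
theorem cSecrecy_timing_implies_runBasedSecrecy (R : Set (ℕ → G)) (hR : R.Nonempty)
    (vi : (ℕ → G) → ℕ → LI) (vj : (ℕ → G) → ℕ → LJ)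
    (hpri : PerfectRecall R vi) (hprj : PerfectRecall R vj)
    (C : (ℕ → G) × ℕ → Set ((ℕ → G) × ℕ)) (hC : IsAllowability R vi C)
    (htime : DependsOnTiming R C) (hsec : CSecrecy R vi vj C) :
    RunBasedSecrecy R vi vj := by
  rintro ⟨r, m⟩ hr ⟨r', m'⟩ hr'
  obtain ⟨htotal, hlater, -, -⟩ := htime
  obtain ⟨t, ht⟩ := htotal r hr r' hr' m'
  rcases le_total m t with hmt | htm
  · obtain ⟨⟨s, k⟩, hi, hj⟩ := hsec (r, t) hr (r', m') ht
    exact ⟨s, hpri.runsThrough_infoSet_subset hr hmt ⟨hi.1, k, hi⟩, hj.1, k, hj⟩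
  · obtain ⟨n', hn', hC'⟩ := hlater r r' t m' m ht htm
    obtain ⟨⟨s, k⟩, hi, hj⟩ := hsec (r, m) hr (r', n') hC'
    exact ⟨s, ⟨hi.1, k, hi⟩, hprj.runsThrough_infoSet_subset hr' hn' ⟨hj.1, k, hj⟩⟩

end Paper
end

section
/- If R is a synchronous system in which agents i and j both have perfect recall, then agent j maintains synchronous secrecy with respect to i if and only if agent j maintains run-based secrecy with respect to i. -/
namespace Paper

variable {G LI LJ : Type*}

/-- The system is synchronous for the agent with local-state projection `v`. -/
def Synchronous {L : Type*} (R : Set (ℕ → G)) (v : (ℕ → G) → ℕ → L) : Prop :=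
  ∀ r ∈ R, ∀ r' ∈ R, ∀ m m' : ℕ, v r m = v r' m' → m = m'

/-- Agent `j` maintains synchronous secrecy with respect to agent `i`. -/
def SyncSecrecy (R : Set (ℕ → G)) (vi : (ℕ → G) → ℕ → LI) (vj : (ℕ → G) → ℕ → LJ) : Prop :=
  ∀ r ∈ R, ∀ r' ∈ R, ∀ m : ℕ,
    (infoSet R vi (r, m) ∩ infoSet R vj (r', m)).Nonempty

/-- In a synchronous system, local-state sequences have no repetitions to delete. -/
theorem Synchronous.lsSeq_eq_map {L : Type*} {R : Set (ℕ → G)} {v : (ℕ → G) → ℕ → L}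
    (hs : Synchronous R v) {r : ℕ → G} (hr : r ∈ R) (m : ℕ) :
    lsSeq v r m = (List.range (m + 1)).map (v r) := by
  have hinj : Function.Injective (v r) := fun a b h => hs r hr r hr a b h
  unfold lsSeq
  exact @List.destutter_of_isChain _ _ (_) _ (List.nodup_range.map hinj).isChain

/-- Under synchrony and perfect recall, runs that an agent cannot distinguish at some time
could not be distinguished earlier either. -/
theorem PerfectRecall.eq_of_le {L : Type*} {R : Set (ℕ → G)} {v : (ℕ → G) → ℕ → L}
    (hp : PerfectRecall R v) (hs : Synchronous R v) {r s : ℕ → G} (hr : r ∈ R) (hsR : s ∈ R)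
    {k m : ℕ} (hkm : k ≤ m) (h : v s m = v r m) : v s k = v r k := by
  have hseq := hp (r, m) (s, m) hr ⟨hsR, h⟩
  simp only [hs.lsSeq_eq_map hr, hs.lsSeq_eq_map hsR] at hseq
  exact List.map_inj_left.mp hseq k (List.mem_range.mpr (Nat.lt_succ_of_le hkm))

/-- in a synchronous system where both agents have perfect recall,
synchronous secrecy and run-based secrecy coincide. -/
theorem syncSecrecy_iff_runBasedSecrecy (R : Set (ℕ → G)) (hR : R.Nonempty)
    (vi : (ℕ → G) → ℕ → LI) (vj : (ℕ → G) → ℕ → LJ)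
    (hsynci : Synchronous R vi) (hsyncj : Synchronous R vj)
    (hpri : PerfectRecall R vi) (hprj : PerfectRecall R vj) :
    SyncSecrecy R vi vj ↔ RunBasedSecrecy R vi vj := by
  constructor
  · rintro h ⟨r, m⟩ hr ⟨r', m'⟩ hr'
    obtain ⟨⟨s, n⟩, ⟨hs, hi⟩, -, hj⟩ := h r hr r' hr' (max m m')
    obtain rfl : n = max m m' := hsynci s hs r hr _ _ hi
    exact ⟨s, ⟨hs, m, hs, hpri.eq_of_le hsynci hr hs (le_max_left m m') hi⟩,
      hs, m', hs, hprj.eq_of_le hsyncj hr' hs (le_max_right m m') hj⟩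
  · intro h r hr r' hr' m
    obtain ⟨s, ⟨hs, a, -, hi⟩, -, b, -, hj⟩ := h (r, m) hr (r', m) hr'
    obtain rfl : a = m := hsynci s hs r hr _ _ hi
    obtain rfl : b = a := hsyncj s hs r' hr' _ _ hj
    exact ⟨(s, b), ⟨hs, hi⟩, hs, hj⟩

end Paper
end

section
/- Let R be a system equipped with a probability assignment for agent i such that, for every point (r,m), the singleton {(r,m)} is μ_{r,m,i}-measurable and μ_{r,m,i}({(r,m)}) > 0. If agent j maintains probabilistic total secrecy with respect to i, then agent j maintains total secrecy with respect to i (i.e., K_i(r,m) ∩ K_j(r',m') ≠ ∅ for all points (r,m) and (r',m')). -/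
open MeasureTheory

namespace Paper

variable {G LI LJ : Type*}

/-- if each point `(r,m)` carries a probability measure `μ (r,m)` (agent `i`'s
subjective probability, on its own σ-algebra `MS (r,m)` of subsets of the points, making
every set `K_j(r'',m'') ∩ K_i(r,m)` measurable) such that singletons `{(r,m)}` are
measurable with positive measure, and `j` maintains probabilistic total secrecy with
respect to `i`, then `j` maintains total secrecy with respect to `i`. -/
theorem probTotalSecrecy_implies_totalSecrecy (R : Set (ℕ → G)) (hR : R.Nonempty)
    (vi : (ℕ → G) → ℕ → LI) (vj : (ℕ → G) → ℕ → LJ)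
    (MS : (ℕ → G) × ℕ → MeasurableSpace ((ℕ → G) × ℕ))
    (μ : (p : (ℕ → G) × ℕ) → @Measure ((ℕ → G) × ℕ) (MS p))
    (hprob : ∀ p ∈ ptsOf R, IsProbabilityMeasure (μ p))
    (hmeas : ∀ p ∈ ptsOf R, ∀ q ∈ ptsOf R,
      MeasurableSet[MS p] (infoSet R vj q ∩ infoSet R vi p))
    (hsing : ∀ p ∈ ptsOf R, MeasurableSet[MS p] {p} ∧ 0 < μ p {p})
    (hsec : ∀ p ∈ ptsOf R, ∀ p' ∈ ptsOf R, ∀ q ∈ ptsOf R,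
      μ p (infoSet R vj q ∩ infoSet R vi p) = μ p' (infoSet R vj q ∩ infoSet R vi p')) :
    TotalSecrecy R vi vj := by
  intro p hp q hq
  have hself : {q} ⊆ infoSet R vj q ∩ infoSet R vi q := by
    rintro x rfl
    exact ⟨⟨hq, rfl⟩, ⟨hq, rfl⟩⟩
  have hpos : 0 < μ p (infoSet R vj q ∩ infoSet R vi p) := by
    rw [hsec p hp q hq q hq]
    exact (hsing q hq).2.trans_le (measure_mono hself)
  rw [Set.inter_comm]
  exact @nonempty_of_measure_ne_zero _ (MS p) (μ p) _ hpos.ne'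

end Paper
end

section
/- Let R be a system and μ_cp a probability measure on a σ-algebra of subsets of PT(R) such that every i-information set and every j-information set is measurable and has positive measure. Then the following are equivalent: (a) for all points (r,m), (r',m'), (r'',m''): μ_cp(K_j(r'',m'') | K_i(r,m)) = μ_cp(K_j(r'',m'') | K_i(r',m')); (b) the same condition with the roles of i and j interchanged; (c) for all points (r,m) and (r',m'): μ_cp(K_j(r',m') ∩ K_i(r,m)) = μ_cp(K_j(r',m')) · μ_cp(K_i(r,m)). (Conditions (a) and (b) say that j, respectively i, maintains probabilistic total secrecy in the probability system obtained from the common prior μ_cp by conditioning each agent's measure on that agent's information set.) -/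
open MeasureTheory

namespace Paper

variable {G LI LJ : Type*}

/-- If a set `A` of points meets every information set of an agent in the same proportion `c`,
then `A` has measure `c`. -/
theorem measure_eq_of_inter_infoSet {L : Type*} {R : Set (ℕ → G)} {v : (ℕ → G) → ℕ → L}
    [MeasurableSpace ((ℕ → G) × ℕ)] {μ : Measure ((ℕ → G) × ℕ)} [IsProbabilityMeasure μ]
    (hfull : μ (ptsOf R) = 1)
    (hv : ∀ p ∈ ptsOf R, MeasurableSet (infoSet R v p) ∧ 0 < μ (infoSet R v p))
    {A : Set ((ℕ → G) × ℕ)} (hA : A ⊆ ptsOf R) {c : ENNReal}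
    (h : ∀ p ∈ ptsOf R, μ (A ∩ infoSet R v p) = c * μ (infoSet R v p)) :
    μ A = c := by
  let S : Set L := (fun p : (ℕ → G) × ℕ => v p.1 p.2) '' ptsOf R
  let T : S → Set ((ℕ → G) × ℕ) := fun l => {q | q.1 ∈ R ∧ v q.1 q.2 = l}
  have hT : ∀ l : S, ∃ p ∈ ptsOf R, T l = infoSet R v p := by
    rintro ⟨_, p, hp, rfl⟩
    exact ⟨p, hp, rfl⟩
  have hmeas : ∀ l, MeasurableSet (T l) := fun l => by
    obtain ⟨p, hp, e⟩ := hT l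
    exact e ▸ (hv p hp).1
  have hpos : ∀ l, 0 < μ (T l) := fun l => by
    obtain ⟨p, hp, e⟩ := hT l
    exact e ▸ (hv p hp).2
  have hdisj : Pairwise (Function.onFun Disjoint T) := fun l l' hne =>
    Set.disjoint_left.2 fun _ hx hx' => hne (Subtype.ext (hx.2.symm.trans hx'.2))
  have hcount : Countable S := by
    have hc := Measure.countable_meas_pos_of_disjoint_iUnion (μ := μ) hmeas hdisj
    rw [Set.eq_univ_of_forall (s := {l | 0 < μ (T l)}) hpos] at hc
    exact Set.countable_univ_iff.1 hc
  have hunion : ⋃ l, T l = ptsOf R := by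
    ext q
    simp only [Set.mem_iUnion]
    exact ⟨fun ⟨_, hq⟩ => hq.1, fun hq => ⟨⟨_, q, hq, rfl⟩, hq, rfl⟩⟩
  calc μ A = μ.restrict A (⋃ l, T l) := by
        rw [Measure.restrict_apply (.iUnion hmeas), hunion, Set.inter_eq_right.2 hA]
    _ = ∑' l, c * μ (T l) := by
        rw [measure_iUnion hdisj hmeas]
        refine tsum_congr fun l => ?_
        rw [Measure.restrict_apply (hmeas l), Set.inter_comm]
        obtain ⟨p, hp, e⟩ := hT l
        rw [e, h p hp]
    _ = c := by
        rw [ENNReal.tsum_mul_left, ← measure_iUnion hdisj hmeas, hunion, hfull, mul_one]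

/-- Conditional probabilities of the `w`-information sets given a `v`-information set are constant
iff the information sets of the two agents are independent. -/
theorem cond_infoSet_const_iff_indep {L L' : Type*} {R : Set (ℕ → G)}
    {v : (ℕ → G) → ℕ → L} {w : (ℕ → G) → ℕ → L'}
    [MeasurableSpace ((ℕ → G) × ℕ)] {μ : Measure ((ℕ → G) × ℕ)} [IsProbabilityMeasure μ]
    (hfull : μ (ptsOf R) = 1)
    (hv : ∀ p ∈ ptsOf R, MeasurableSet (infoSet R v p) ∧ 0 < μ (infoSet R v p)) :
    (∀ p ∈ ptsOf R, ∀ p' ∈ ptsOf R, ∀ q ∈ ptsOf R,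
        μ (infoSet R w q ∩ infoSet R v p) / μ (infoSet R v p) =
          μ (infoSet R w q ∩ infoSet R v p') / μ (infoSet R v p')) ↔
      (∀ p ∈ ptsOf R, ∀ q ∈ ptsOf R,
        μ (infoSet R w q ∩ infoSet R v p) = μ (infoSet R w q) * μ (infoSet R v p)) := by
  have hne : ∀ p ∈ ptsOf R, μ (infoSet R v p) ≠ 0 := fun p hp => (hv p hp).2.ne'
  constructor
  · intro h p hp q hq
    have key : μ (infoSet R w q) = μ (infoSet R w q ∩ infoSet R v p) / μ (infoSet R v p) :=
      measure_eq_of_inter_infoSet hfull hv (fun _ hx => hx.1) fun p' hp' => by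
        rw [h p hp p' hp' q hq, ENNReal.div_mul_cancel (hne p' hp') (measure_ne_top μ _)]
    rw [key, ENNReal.div_mul_cancel (hne p hp) (measure_ne_top μ _)]
  · intro h p hp p' hp' q hq
    rw [h p hp q hq, h p' hp' q hq, ENNReal.mul_div_cancel_right (hne p hp) (measure_ne_top μ _),
      ENNReal.mul_div_cancel_right (hne p' hp') (measure_ne_top μ _)]

/-- for a common-prior probability measure `μcp` on the points of `R` (all
`i`- and `j`-information sets measurable with positive measure), the following are
equivalent: (a) probabilistic total secrecy of `j` with respect to `i`, i.e.
`μcp(K_j(r'',m'') | K_i(r,m))` does not depend on the point `(r,m)`; (b) the same with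
`i` and `j` interchanged; (c) every `i`-information set is independent of every
`j`-information set. -/
theorem common_prior_total_secrecy_equiv (R : Set (ℕ → G)) (hR : R.Nonempty)
    (vi : (ℕ → G) → ℕ → LI) (vj : (ℕ → G) → ℕ → LJ)
    [MeasurableSpace ((ℕ → G) × ℕ)] (μcp : Measure ((ℕ → G) × ℕ))
    [IsProbabilityMeasure μcp] (hfull : μcp (ptsOf R) = 1)
    (hmeasI : ∀ p ∈ ptsOf R, MeasurableSet (infoSet R vi p) ∧ 0 < μcp (infoSet R vi p))
    (hmeasJ : ∀ p ∈ ptsOf R, MeasurableSet (infoSet R vj p) ∧ 0 < μcp (infoSet R vj p)) :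
    ((∀ p ∈ ptsOf R, ∀ p' ∈ ptsOf R, ∀ q ∈ ptsOf R,
        μcp (infoSet R vj q ∩ infoSet R vi p) / μcp (infoSet R vi p) =
          μcp (infoSet R vj q ∩ infoSet R vi p') / μcp (infoSet R vi p')) ↔
      (∀ p ∈ ptsOf R, ∀ p' ∈ ptsOf R, ∀ q ∈ ptsOf R,
        μcp (infoSet R vi q ∩ infoSet R vj p) / μcp (infoSet R vj p) =
          μcp (infoSet R vi q ∩ infoSet R vj p') / μcp (infoSet R vj p'))) ∧
    ((∀ p ∈ ptsOf R, ∀ p' ∈ ptsOf R, ∀ q ∈ ptsOf R,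
        μcp (infoSet R vj q ∩ infoSet R vi p) / μcp (infoSet R vi p) =
          μcp (infoSet R vj q ∩ infoSet R vi p') / μcp (infoSet R vi p')) ↔
      (∀ p ∈ ptsOf R, ∀ q ∈ ptsOf R,
        μcp (infoSet R vj q ∩ infoSet R vi p) =
          μcp (infoSet R vj q) * μcp (infoSet R vi p))) := by
  have hij := cond_infoSet_const_iff_indep (w := vj) hfull hmeasI
  refine ⟨hij.trans (Iff.trans ?_ (cond_infoSet_const_iff_indep (w := vi) hfull hmeasJ).symm), hij⟩
  constructor <;> intro h p hp q hq <;> rw [Set.inter_comm, mul_comm, h q hq p hp]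


end Paper
end

section
/- Let R be a synchronous system and μ_cp a probability measure on a σ-algebra of subsets of PT(R) such that every i-information set and every j-information set is measurable and has positive measure; for a time m let PT(m) denote the set of time-m points (which is measurable, being a countable disjoint union of positive-measure i-information sets). Then the following are equivalent: (a) for all runs r, r', r'' ∈ R and all times m: μ_cp(K_j(r'',m) | K_i(r,m)) = μ_cp(K_j(r'',m) | K_i(r',m)); (b) the same condition with the roles of i and j interchanged; (c) for all runs r, r' ∈ R and all times m: μ_cp(K_j(r',m) | K_i(r,m)) = μ_cp(K_j(r',m) | PT(m)), i.e., K_i(r,m) and K_j(r',m) are conditionally independent given PT(m). -/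
open MeasureTheory

namespace Paper

variable {G LI LJ : Type*}

/-- The set of time-`m` points of the system `R`. -/
def ptsAt (R : Set (ℕ → G)) (m : ℕ) : Set ((ℕ → G) × ℕ) := {p | p.1 ∈ R ∧ p.2 = m}

/-- If each of a family of pairwise disjoint measurable sets of positive measure meets `B` in the
same proportion `c`, then so does the union of the family. -/
theorem measure_inter_sUnion_eq_mul {α : Type*} [MeasurableSpace α] {μ : Measure α}
    [SFinite μ] {S : Set (Set α)} (hd : S.Pairwise Disjoint)
    (hS : ∀ A ∈ S, MeasurableSet A ∧ 0 < μ A) {B : Set α} {c : ENNReal}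
    (hc : ∀ A ∈ S, μ (B ∩ A) = c * μ A) : μ (B ∩ ⋃₀ S) = c * μ (⋃₀ S) := by
  have hcount : S.Countable := by
    have h := Measure.countable_meas_pos_of_disjoint_iUnion (μ := μ) (As := ((↑) : S → Set α))
      (fun A => (hS A A.2).1) (fun A A' h => hd A.2 A'.2 (Subtype.coe_injective.ne h))
    have huniv : {A : S | 0 < μ (A : Set α)} = Set.univ :=
      Set.eq_univ_of_forall fun A => (hS A A.2).2
    rw [huniv] at h
    exact Set.countable_coe_iff.mp (Set.countable_univ_iff.mp h)
  have hm : ∀ A ∈ S, MeasurableSet A := fun A hA => (hS A hA).1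
  calc μ (B ∩ ⋃₀ S) = μ.restrict B (⋃₀ S) := by
        rw [Measure.restrict_apply (MeasurableSet.sUnion hcount hm), Set.inter_comm]
    _ = ∑' A : S, μ.restrict B A := measure_sUnion hcount hd hm
    _ = ∑' A : S, c * μ A := by
        refine tsum_congr fun A => ?_
        rw [Measure.restrict_apply (hm A A.2), Set.inter_comm, hc A A.2]
    _ = c * μ (⋃₀ S) := by rw [ENNReal.tsum_mul_left, measure_sUnion hcount hd hm]

section InfoSet

variable {L : Type*} {R : Set (ℕ → G)} {v : (ℕ → G) → ℕ → L} {r : ℕ → G} {m : ℕ}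

theorem mem_infoSet_self_s9 (hr : r ∈ R) : (r, m) ∈ infoSet R v (r, m) := ⟨hr, rfl⟩

theorem infoSet_eq_or_disjoint (p q : (ℕ → G) × ℕ) :
    infoSet R v p = infoSet R v q ∨ Disjoint (infoSet R v p) (infoSet R v q) := by
  by_cases h : v p.1 p.2 = v q.1 q.2
  · left
    simp only [infoSet, h]
  · right
    exact Set.disjoint_left.mpr fun x hx hy => h (hx.2.symm.trans hy.2)

theorem Synchronous.infoSet_subset_ptsAt (hv : Synchronous R v) (hr : r ∈ R) :
    infoSet R v (r, m) ⊆ ptsAt R m :=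
  fun q hq => ⟨hq.1, hv q.1 hq.1 r hr q.2 m hq.2⟩

theorem Synchronous.sUnion_infoSet_eq_ptsAt (hv : Synchronous R v) (m : ℕ) :
    ⋃₀ ((fun r => infoSet R v (r, m)) '' R) = ptsAt R m := by
  refine subset_antisymm (Set.sUnion_subset ?_) ?_
  · rintro _ ⟨r, hr, rfl⟩
    exact hv.infoSet_subset_ptsAt hr
  · rintro ⟨r, n⟩ ⟨hr, rfl⟩
    exact ⟨_, ⟨r, hr, rfl⟩, mem_infoSet_self_s9 hr⟩

variable [MeasurableSpace ((ℕ → G) × ℕ)] {μ : Measure ((ℕ → G) × ℕ)}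

theorem Synchronous.measure_ptsAt_ne_zero (hv : Synchronous R v)
    (hmeas : ∀ p ∈ ptsOf R, MeasurableSet (infoSet R v p) ∧ 0 < μ (infoSet R v p))
    (hr : r ∈ R) : μ (ptsAt R m) ≠ 0 :=
  ((hmeas (r, m) hr).2.trans_le (measure_mono (hv.infoSet_subset_ptsAt hr))).ne'

/-- The conditional probability of `B` is the same on all time-`m` information sets iff on each of
them it agrees with the conditional probability of `B` given the time-`m` points. -/
theorem Synchronous.forall_cond_eq_iff [IsFiniteMeasure μ] (hv : Synchronous R v)
    (hmeas : ∀ p ∈ ptsOf R, MeasurableSet (infoSet R v p) ∧ 0 < μ (infoSet R v p))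
    (B : Set ((ℕ → G) × ℕ)) (m : ℕ) :
    (∀ r ∈ R, ∀ r' ∈ R, μ (B ∩ infoSet R v (r, m)) / μ (infoSet R v (r, m)) =
        μ (B ∩ infoSet R v (r', m)) / μ (infoSet R v (r', m))) ↔
      ∀ r ∈ R, μ (B ∩ infoSet R v (r, m)) / μ (infoSet R v (r, m)) =
        μ (B ∩ ptsAt R m) / μ (ptsAt R m) := by
  refine ⟨fun h r hr => ?_, fun h r hr r' hr' => (h r hr).trans (h r' hr').symm⟩
  have key : μ (B ∩ ⋃₀ ((fun r => infoSet R v (r, m)) '' R)) =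
      μ (B ∩ infoSet R v (r, m)) / μ (infoSet R v (r, m)) *
        μ (⋃₀ ((fun r => infoSet R v (r, m)) '' R)) := by
    apply measure_inter_sUnion_eq_mul
    · rintro _ ⟨s, _, rfl⟩ _ ⟨t, _, rfl⟩ hne
      exact (infoSet_eq_or_disjoint _ _).resolve_left hne
    · rintro _ ⟨s, hs, rfl⟩
      exact hmeas (s, m) hs
    · rintro _ ⟨s, hs, rfl⟩
      dsimp only
      rw [h r hr s hs, ENNReal.div_mul_cancel (hmeas (s, m) hs).2.ne' (measure_ne_top _ _)]
  rw [hv.sUnion_infoSet_eq_ptsAt] at key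
  rw [key, ENNReal.mul_div_cancel_right (hv.measure_ptsAt_ne_zero hmeas hr) (measure_ne_top _ _)]

end InfoSet

/-- Conditional independence given `T` is symmetric. -/
theorem cond_eq_cond_comm {α : Type*} [MeasurableSpace α] {μ : Measure α} [IsFiniteMeasure μ]
    {A B T : Set α} (hAT : A ⊆ T) (hBT : B ⊆ T) (hA : μ A ≠ 0) (hB : μ B ≠ 0) (hT : μ T ≠ 0) :
    μ (B ∩ A) / μ A = μ (B ∩ T) / μ T ↔ μ (A ∩ B) / μ B = μ (A ∩ T) / μ T := by
  rw [Set.inter_eq_left.mpr hAT, Set.inter_eq_left.mpr hBT, Set.inter_comm A B,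
    ENNReal.div_eq_div_iff hT (measure_ne_top _ _) hA (measure_ne_top _ _),
    ENNReal.div_eq_div_iff hT (measure_ne_top _ _) hB (measure_ne_top _ _), mul_comm (μ A)]

/-- for a synchronous system with a common-prior probability measure `μcp` on
the points of `R` (all `i`- and `j`-information sets measurable with positive measure),
the following are equivalent: (a) probabilistic synchronous secrecy of `j` with respect
to `i`; (b) the same with `i` and `j` interchanged; (c) `K_i(r,m)` and `K_j(r',m)` are
conditionally independent given the set `PT(m)` of time-`m` points. -/
theorem common_prior_sync_secrecy_equiv (R : Set (ℕ → G)) (hR : R.Nonempty)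
    (vi : (ℕ → G) → ℕ → LI) (vj : (ℕ → G) → ℕ → LJ)
    (hsynci : Synchronous R vi) (hsyncj : Synchronous R vj)
    [MeasurableSpace ((ℕ → G) × ℕ)] (μcp : Measure ((ℕ → G) × ℕ))
    [IsProbabilityMeasure μcp] (hfull : μcp (ptsOf R) = 1)
    (hmeasI : ∀ p ∈ ptsOf R, MeasurableSet (infoSet R vi p) ∧ 0 < μcp (infoSet R vi p))
    (hmeasJ : ∀ p ∈ ptsOf R, MeasurableSet (infoSet R vj p) ∧ 0 < μcp (infoSet R vj p)) :
    ((∀ r ∈ R, ∀ r' ∈ R, ∀ r'' ∈ R, ∀ m : ℕ,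
        μcp (infoSet R vj (r'', m) ∩ infoSet R vi (r, m)) / μcp (infoSet R vi (r, m)) =
          μcp (infoSet R vj (r'', m) ∩ infoSet R vi (r', m)) /
            μcp (infoSet R vi (r', m))) ↔
      (∀ r ∈ R, ∀ r' ∈ R, ∀ r'' ∈ R, ∀ m : ℕ,
        μcp (infoSet R vi (r'', m) ∩ infoSet R vj (r, m)) / μcp (infoSet R vj (r, m)) =
          μcp (infoSet R vi (r'', m) ∩ infoSet R vj (r', m)) /
            μcp (infoSet R vj (r', m)))) ∧
    ((∀ r ∈ R, ∀ r' ∈ R, ∀ r'' ∈ R, ∀ m : ℕ,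
        μcp (infoSet R vj (r'', m) ∩ infoSet R vi (r, m)) / μcp (infoSet R vi (r, m)) =
          μcp (infoSet R vj (r'', m) ∩ infoSet R vi (r', m)) /
            μcp (infoSet R vi (r', m))) ↔
      (∀ r ∈ R, ∀ r' ∈ R, ∀ m : ℕ,
        μcp (infoSet R vj (r', m) ∩ infoSet R vi (r, m)) / μcp (infoSet R vi (r, m)) =
          μcp (infoSet R vj (r', m) ∩ ptsAt R m) / μcp (ptsAt R m))) := by
  have hac := fun s m => hsynci.forall_cond_eq_iff hmeasI (infoSet R vj (s, m)) m
  have hbc := fun s m => hsyncj.forall_cond_eq_iff hmeasJ (infoSet R vi (s, m)) m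
  have hcomm : ∀ r ∈ R, ∀ s ∈ R, ∀ m, _ := fun r hr s hs m =>
    cond_eq_cond_comm (μ := μcp) (hsynci.infoSet_subset_ptsAt (m := m) hr)
      (hsyncj.infoSet_subset_ptsAt (m := m) hs) (hmeasI (r, m) hr).2.ne' (hmeasJ (s, m) hs).2.ne'
      (hsynci.measure_ptsAt_ne_zero hmeasI hr)
  refine ⟨⟨fun h r hr r' hr' s hs m => ?_, fun h r hr r' hr' s hs m => ?_⟩,
    ⟨fun h r hr s hs m => ?_, fun h r hr r' hr' s hs m => ?_⟩⟩
  · exact (hbc s m).mpr (fun t ht => (hcomm s hs t ht m).mp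
      ((hac t m).mp (fun x hx y hy => h x hx y hy t ht m) s hs)) r hr r' hr'
  · exact (hac s m).mpr (fun t ht => (hcomm t ht s hs m).mpr
      ((hbc t m).mp (fun x hx y hy => h x hx y hy t ht m) s hs)) r hr r' hr'
  · exact (hac s m).mp (fun x hx y hy => h x hx y hy s hs m) r hr
  · exact (hac s m).mpr (fun x hx => h x hx s hs m) r hr r' hr'

end Paper
end

section
/- Let (R,F,μ) be a run-based probability system and suppose that R is synchronous or that agents i and j both have perfect recall. Then the following are equivalent: (a) agent j maintains run-based probabilistic secrecy with respect to i; (b) agent i maintains run-based probabilistic secrecy with respect to j; (c) for all points (r,m) and (r',m'), μ(R(K_i(r,m)) ∩ R(K_j(r',m'))) = μ(R(K_i(r,m))) · μ(R(K_j(r',m'))). -/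
open MeasureTheory

namespace Paper

variable {G LI LJ : Type*}

/-- In the run-based probability system `(R,F,μ)`, the agent with local states `vb`
maintains run-based probabilistic secrecy with respect to the agent with local states
`va`: the conditional probability `μ(R(K_b(r'',m'')) | R(K_a(r,m)))` does not depend on
the point `(r,m)`. -/
def RunBasedProbSecrecy {LA LB : Type*} [MeasurableSpace (ℕ → G)]
    (μ : Measure (ℕ → G)) (R : Set (ℕ → G))
    (va : (ℕ → G) → ℕ → LA) (vb : (ℕ → G) → ℕ → LB) : Prop :=
  ∀ p ∈ ptsOf R, ∀ p' ∈ ptsOf R, ∀ q ∈ ptsOf R,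
    μ (runsThrough R (infoSet R vb q) ∩ runsThrough R (infoSet R va p)) /
        μ (runsThrough R (infoSet R va p)) =
      μ (runsThrough R (infoSet R vb q) ∩ runsThrough R (infoSet R va p')) /
        μ (runsThrough R (infoSet R va p'))

theorem head?_destutter' {α : Type*} (r : α → α → Prop) [DecidableRel r] (a : α) (l : List α) :
    (l.destutter' r a).head? = some a := by
  induction l with
  | nil => simp
  | cons b l ih =>
    rw [List.destutter']
    split_ifs
    · simp
    · exact ih

theorem head?_lsSeq {L : Type*} (v : (ℕ → G) → ℕ → L) (r : ℕ → G) (m : ℕ) :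
    (lsSeq v r m).head? = some (v r 0) := by
  rw [lsSeq, List.range_succ_eq_map, List.map_cons]
  exact @head?_destutter' _ _ (_) _ _

/-- Every run of `R` passing through an initial local state starts in that local state. -/
def InitialStatesOnlyInitial {L : Type*} (R : Set (ℕ → G)) (v : (ℕ → G) → ℕ → L) : Prop :=
  ∀ r ∈ R, ∀ r' ∈ R, ∀ m : ℕ, v r' m = v r 0 → v r' 0 = v r 0

theorem Synchronous.initialStatesOnlyInitial {L : Type*} {R : Set (ℕ → G)}
    {v : (ℕ → G) → ℕ → L} (h : Synchronous R v) : InitialStatesOnlyInitial R v := by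
  intro r hr r' hr' m hm
  obtain rfl := h r' hr' r hr m 0 hm
  exact hm

theorem PerfectRecall.initialStatesOnlyInitial {L : Type*} {R : Set (ℕ → G)}
    {v : (ℕ → G) → ℕ → L} (h : PerfectRecall R v) : InitialStatesOnlyInitial R v := by
  intro r hr r' hr' m hm
  have := congrArg List.head? (h (r, 0) (r', m) hr ⟨hr', hm⟩)
  simpa [head?_lsSeq] using this

/-- If a measurable set `B` has the same conditional probability given every member of a
measurable family of sets of positive measure that partitions a set of full measure containing
`B`, then this conditional probability is `μ B`. -/
theorem eq_measure_of_forall_inter_eq_mul {Ω ι : Type*} [MeasurableSpace Ω] {μ : Measure Ω}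
    [IsProbabilityMeasure μ] {A : ι → Set Ω} {B : Set Ω} {c : ENNReal}
    (hA : ∀ i, MeasurableSet (A i)) (hpos : ∀ i, 0 < μ (A i))
    (hdisj : Pairwise (Function.onFun Disjoint A)) (hfull : μ (⋃ i, A i) = 1)
    (hB : MeasurableSet B) (hsub : B ⊆ ⋃ i, A i) (h : ∀ i, μ (B ∩ A i) = c * μ (A i)) :
    c = μ B := by
  have hc : Countable ι := by
    have := Measure.countable_meas_pos_of_disjoint_iUnion (μ := μ) hA hdisj
    simpa [hpos, Set.countable_univ_iff] using this
  calc c = c * μ (⋃ i, A i) := by rw [hfull, mul_one]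
    _ = ∑' i, μ (B ∩ A i) := by
      rw [measure_iUnion hdisj hA, ← ENNReal.tsum_mul_left]
      exact tsum_congr fun i => (h i).symm
    _ = μ (⋃ i, B ∩ A i) :=
      (measure_iUnion (fun i j hij => (hdisj hij).mono Set.inter_subset_right
        Set.inter_subset_right) fun i => hB.inter (hA i)).symm
    _ = μ B := by rw [← Set.inter_iUnion, Set.inter_eq_left.2 hsub]

theorem runBasedProbSecrecy_iff_independence {LA LB : Type*} {R : Set (ℕ → G)}
    {va : (ℕ → G) → ℕ → LA} {vb : (ℕ → G) → ℕ → LB}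
    [MeasurableSpace (ℕ → G)] {μ : Measure (ℕ → G)} [IsProbabilityMeasure μ]
    (hfull : μ R = 1)
    (hA : ∀ p ∈ ptsOf R, MeasurableSet (runsThrough R (infoSet R va p)) ∧
      0 < μ (runsThrough R (infoSet R va p)))
    (hB : ∀ p ∈ ptsOf R, MeasurableSet (runsThrough R (infoSet R vb p)))
    (hinit : InitialStatesOnlyInitial R va) :
    RunBasedProbSecrecy μ R va vb ↔
      ∀ p ∈ ptsOf R, ∀ q ∈ ptsOf R,
        μ (runsThrough R (infoSet R va p) ∩ runsThrough R (infoSet R vb q)) =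
          μ (runsThrough R (infoSet R va p)) * μ (runsThrough R (infoSet R vb q)) := by
  constructor
  · intro h p hp q hq
    have hS : ∀ s : (fun r => va r 0) '' R, ∃ r ∈ R, va r 0 = s := fun s => s.2
    choose ρ hρ hρs using hS
    have hmem : ∀ s r, r ∈ runsThrough R (infoSet R va (ρ s, 0)) ↔ r ∈ R ∧ va r 0 = s := by
      intro s r
      constructor
      · rintro ⟨hr, m, -, hm⟩
        exact ⟨hr, (hinit _ (hρ s) r hr m hm).trans (hρs s)⟩
      · rintro ⟨hr, hs⟩
        exact ⟨hr, 0, hr, hs.trans (hρs s).symm⟩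
    have hU : ⋃ s, runsThrough R (infoSet R va (ρ s, 0)) = R := by
      ext r
      simp only [Set.mem_iUnion, hmem]
      exact ⟨fun ⟨_, hr, _⟩ => hr, fun hr => ⟨⟨va r 0, r, hr, rfl⟩, hr, rfl⟩⟩
    have key := eq_measure_of_forall_inter_eq_mul (μ := μ)
      (A := fun s => runsThrough R (infoSet R va (ρ s, 0)))
      (B := runsThrough R (infoSet R vb q))
      (c := μ (runsThrough R (infoSet R vb q) ∩ runsThrough R (infoSet R va p)) /
        μ (runsThrough R (infoSet R va p)))
      (fun s => (hA _ (hρ s)).1) (fun s => (hA _ (hρ s)).2)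
      (fun s t hst => Set.disjoint_left.2 fun r hs ht =>
        hst (Subtype.ext (((hmem s r).1 hs).2.symm.trans ((hmem t r).1 ht).2)))
      (by rw [hU, hfull]) (hB q hq) (by rw [hU]; exact fun r hr => hr.1)
      (fun s => by
        rw [h p hp (ρ s, 0) (hρ s) q hq,
          ENNReal.div_mul_cancel (hA _ (hρ s)).2.ne' (measure_ne_top _ _)])
    rw [← key, Set.inter_comm, ENNReal.mul_div_cancel (hA p hp).2.ne' (measure_ne_top _ _)]
  · intro h
    have hcond : ∀ p ∈ ptsOf R, ∀ q ∈ ptsOf R,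
        μ (runsThrough R (infoSet R vb q) ∩ runsThrough R (infoSet R va p)) /
          μ (runsThrough R (infoSet R va p)) = μ (runsThrough R (infoSet R vb q)) := by
      intro p hp q hq
      rw [Set.inter_comm, h p hp q hq, mul_comm,
        ENNReal.mul_div_cancel_right (hA p hp).2.ne' (measure_ne_top _ _)]
    intro p hp p' hp' q hq
    rw [hcond p hp q hq, hcond p' hp' q hq]

/-- in a run-based probability system that is synchronous or in which both
agents have perfect recall, the following are equivalent: (a) `j` maintains run-based
probabilistic secrecy with respect to `i`; (b) `i` maintains run-based probabilistic
secrecy with respect to `j`; (c) the run-sets of `i`-information sets and of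
`j`-information sets are probabilistically independent. -/
theorem runBasedProbSecrecy_symm_and_independence (R : Set (ℕ → G)) (hR : R.Nonempty)
    (vi : (ℕ → G) → ℕ → LI) (vj : (ℕ → G) → ℕ → LJ)
    [MeasurableSpace (ℕ → G)] (μ : Measure (ℕ → G)) [IsProbabilityMeasure μ]
    (hfull : μ R = 1)
    (hmeasI : ∀ p ∈ ptsOf R, MeasurableSet (runsThrough R (infoSet R vi p)) ∧
      0 < μ (runsThrough R (infoSet R vi p)))
    (hmeasJ : ∀ p ∈ ptsOf R, MeasurableSet (runsThrough R (infoSet R vj p)) ∧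
      0 < μ (runsThrough R (infoSet R vj p)))
    (hyp : (Synchronous R vi ∧ Synchronous R vj) ∨
      (PerfectRecall R vi ∧ PerfectRecall R vj)) :
    (RunBasedProbSecrecy μ R vi vj ↔ RunBasedProbSecrecy μ R vj vi) ∧
    (RunBasedProbSecrecy μ R vi vj ↔
      ∀ p ∈ ptsOf R, ∀ q ∈ ptsOf R,
        μ (runsThrough R (infoSet R vi p) ∩ runsThrough R (infoSet R vj q)) =
          μ (runsThrough R (infoSet R vi p)) * μ (runsThrough R (infoSet R vj q))) := by
  have hinitI : InitialStatesOnlyInitial R vi := hyp.elim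
    (fun h => h.1.initialStatesOnlyInitial) fun h => h.1.initialStatesOnlyInitial
  have hinitJ : InitialStatesOnlyInitial R vj := hyp.elim
    (fun h => h.2.initialStatesOnlyInitial) fun h => h.2.initialStatesOnlyInitial
  have hI := runBasedProbSecrecy_iff_independence hfull hmeasI (fun q hq => (hmeasJ q hq).1) hinitI
  have hJ := runBasedProbSecrecy_iff_independence hfull hmeasJ (fun q hq => (hmeasI q hq).1) hinitJ
  refine ⟨hI.trans (Iff.trans ?_ hJ.symm), hI⟩
  constructor <;> intro h p hp q hq <;> rw [Set.inter_comm, mul_comm] <;> exact h q hq p hp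

end Paper
end

section
/- Let R be a synchronous system with a probability assignment for agent i such that μ_{r,m,i}(K_i(r,m)) = 1 for every point (r,m), and assume that only countably many distinct local states of agent j occur at points of R. Say that agent j maintains probabilistic synchronous secrecy with respect to i if μ_{r,m,i}(K_j(r'',m) ∩ K_i(r,m)) = μ_{r',m,i}(K_j(r'',m) ∩ K_i(r',m)) for all runs r, r', r'' ∈ R and all times m. Then agent j maintains probabilistic synchronous secrecy with respect to i if and only if for every j-local set S of points and every time m there exists a constant σ_m ∈ [0,1] such that μ_{r,m,i}(S ∩ K_i(r,m)) = σ_m for every run r ∈ R. -/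
open MeasureTheory
open scoped ENNReal

namespace Paper

variable {G LI LJ : Type*}

/-- In a synchronous system, the measure of the part of a `j`-local set lying in an information
set of agent `i` at time `m` is the sum of the measures of its `j`-local pieces. -/
theorem measure_localSet_inter_infoSet {R : Set (ℕ → G)} {vi : (ℕ → G) → ℕ → LI}
    {vj : (ℕ → G) → ℕ → LJ} (hsynci : Synchronous R vi) [MeasurableSpace ((ℕ → G) × ℕ)]
    (ν : Measure ((ℕ → G) × ℕ)) {r : ℕ → G} (hr : r ∈ R) (m : ℕ)
    (hmeas : ∀ q ∈ ptsOf R, MeasurableSet (infoSet R vj q ∩ infoSet R vi (r, m)))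
    (hcount : {s : LJ | ∃ p ∈ ptsOf R, vj p.1 p.2 = s}.Countable)
    {S : Set ((ℕ → G) × ℕ)} (hS : IsLocalSet R vj S) :
    ν (S ∩ infoSet R vi (r, m)) =
      ∑' s : {s : LJ | ∃ r' ∈ R, (r', m) ∈ S ∧ vj r' m = s},
        ν ({q | q.1 ∈ R ∧ vj q.1 q.2 = s} ∩ infoSet R vi (r, m)) := by
  have hunion : S ∩ infoSet R vi (r, m) =
      ⋃ s ∈ {s : LJ | ∃ r' ∈ R, (r', m) ∈ S ∧ vj r' m = s},
        {q | q.1 ∈ R ∧ vj q.1 q.2 = s} ∩ infoSet R vi (r, m) := by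
    ext ⟨a, n⟩
    simp only [Set.mem_iUnion, Set.mem_inter_iff, exists_prop]
    constructor
    · rintro ⟨haS, haR, hai⟩
      obtain rfl : n = m := hsynci a haR r hr n m hai
      exact ⟨vj a n, ⟨a, haR, haS, rfl⟩, ⟨haR, rfl⟩, haR, hai⟩
    · rintro ⟨s, ⟨r', hr', hr'S, rfl⟩, ⟨haR, haj⟩, hai⟩
      exact ⟨(hS.2 (a, n) (r', m) haR hr' haj).2 hr'S, hai⟩
  rw [hunion]
  refine measure_biUnion (hcount.mono ?_) ?_ ?_
  · rintro s ⟨r', hr', -, rfl⟩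
    exact ⟨(r', m), hr', rfl⟩
  · intro s _ t _ hst
    exact Set.disjoint_left.2 fun q hq hq' => hst (hq.1.2.symm.trans hq'.1.2)
  · rintro s ⟨r', hr', -, rfl⟩
    exact hmeas (r', m) hr'

/-- in a synchronous system with a probability assignment for agent `i`
concentrated on the current information set, and with only countably many local states
of agent `j`, agent `j` maintains probabilistic synchronous secrecy with respect to `i`
iff for every `j`-local set `S` and time `m` there is a constant `σ_m ∈ [0,1]` with
`μ (r,m) (S ∩ K_i(r,m)) = σ_m` for every run `r ∈ R`. -/
theorem probSyncSecrecy_iff_constant_on_jLocal (R : Set (ℕ → G)) (hR : R.Nonempty)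
    (vi : (ℕ → G) → ℕ → LI) (vj : (ℕ → G) → ℕ → LJ)
    (hsynci : Synchronous R vi) (hsyncj : Synchronous R vj)
    (MS : (ℕ → G) × ℕ → MeasurableSpace ((ℕ → G) × ℕ))
    (μ : (p : (ℕ → G) × ℕ) → @Measure ((ℕ → G) × ℕ) (MS p))
    (hprob : ∀ p ∈ ptsOf R, IsProbabilityMeasure (μ p))
    (hmeas : ∀ p ∈ ptsOf R, ∀ q ∈ ptsOf R,
      MeasurableSet[MS p] (infoSet R vj q ∩ infoSet R vi p))
    (hconc : ∀ p ∈ ptsOf R, μ p (infoSet R vi p) = 1)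
    (hcount : {s : LJ | ∃ p ∈ ptsOf R, vj p.1 p.2 = s}.Countable) :
    (∀ r ∈ R, ∀ r' ∈ R, ∀ r'' ∈ R, ∀ m : ℕ,
        μ (r, m) (infoSet R vj (r'', m) ∩ infoSet R vi (r, m)) =
          μ (r', m) (infoSet R vj (r'', m) ∩ infoSet R vi (r', m))) ↔
      (∀ S : Set ((ℕ → G) × ℕ), IsLocalSet R vj S → ∀ m : ℕ,
        ∃ σ : ℝ≥0∞, σ ≤ 1 ∧ ∀ r ∈ R, μ (r, m) (S ∩ infoSet R vi (r, m)) = σ) := by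
  constructor
  · intro h S hS m
    obtain ⟨r₀, hr₀⟩ := hR
    refine ⟨μ (r₀, m) (S ∩ infoSet R vi (r₀, m)), ?_, fun r hr => ?_⟩
    · exact (measure_mono Set.inter_subset_right).trans (hconc (r₀, m) hr₀).le
    · rw [@measure_localSet_inter_infoSet _ _ _ R vi vj hsynci (MS (r, m)) (μ (r, m)) r hr m
          (hmeas (r, m) hr) hcount S hS,
        @measure_localSet_inter_infoSet _ _ _ R vi vj hsynci (MS (r₀, m)) (μ (r₀, m)) r₀ hr₀ m
          (hmeas (r₀, m) hr₀) hcount S hS]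
      refine tsum_congr ?_
      rintro ⟨s, r', hr', -, rfl⟩
      exact h r hr r₀ hr₀ r' hr' m
  · intro h r hr r' hr' r'' _ m
    obtain ⟨σ, -, hσ⟩ := h (infoSet R vj (r'', m))
      ⟨fun q hq => hq.1, fun p q hp hq hpq =>
        ⟨fun hp' => ⟨hq, hpq.symm.trans hp'.2⟩, fun hq' => ⟨hp, hpq.trans hq'.2⟩⟩⟩ m
    rw [hσ r hr, hσ r' hr']

end Paper
end

section
/- Let Σ be a limit-closed synchronous trace system. Then Σ satisfies separability if and only if H maintains synchronous secrecy with respect to L in R(Σ) (i.e., for all τ, τ' ∈ Σ and every time m there exists τ'' ∈ Σ with τ''_m|_L = τ_m|_L and τ''_m|_H = τ'_m|_H); likewise, Σ satisfies generalized noninterference if and only if H maintains synchronous f_hi-secrecy with respect to L in R(Σ) (the same condition with |_H replaced by |_HI). -/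
namespace Paper

variable {LI HI LO HO : Type*}

/-- A synchronous trace: an infinite sequence of tuples of a low input, high input,
low output, and high output value. -/
abbrev STrace (LI HI LO HO : Type*) := ℕ → LI × HI × LO × HO

/-- The low-level projection `τ|_L` of a synchronous trace. -/
def projL (τ : STrace LI HI LO HO) : ℕ → LI × LO := fun k => ((τ k).1, (τ k).2.2.1)

/-- The high-level projection `τ|_H` of a synchronous trace. -/
def projH (τ : STrace LI HI LO HO) : ℕ → HI × HO := fun k => ((τ k).2.1, (τ k).2.2.2)

/-- The high-input projection `τ|_HI` of a synchronous trace. -/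
def projHI (τ : STrace LI HI LO HO) : ℕ → HI := fun k => (τ k).2.1

/-- `S` satisfies separability. -/
def Separability (S : Set (STrace LI HI LO HO)) : Prop :=
  ∀ τ ∈ S, ∀ τ' ∈ S, ∃ τ'' ∈ S, projL τ'' = projL τ ∧ projH τ'' = projH τ'

/-- `S` satisfies generalized noninterference. -/
def GeneralizedNI (S : Set (STrace LI HI LO HO)) : Prop :=
  ∀ τ ∈ S, ∀ τ' ∈ S, ∃ τ'' ∈ S, projL τ'' = projL τ ∧ projHI τ'' = projHI τ'

/-- `H` maintains synchronous secrecy with respect to `L` in `R(S)`. -/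
def SyncSecrecyHL (S : Set (STrace LI HI LO HO)) : Prop :=
  ∀ τ ∈ S, ∀ τ' ∈ S, ∀ m : ℕ, ∃ τ'' ∈ S,
    (∀ k < m, projL τ'' k = projL τ k) ∧ (∀ k < m, projH τ'' k = projH τ' k)

/-- `H` maintains synchronous `f_hi`-secrecy with respect to `L` in `R(S)`. -/
def SyncFhiSecrecy (S : Set (STrace LI HI LO HO)) : Prop :=
  ∀ τ ∈ S, ∀ τ' ∈ S, ∀ m : ℕ, ∃ τ'' ∈ S,
    (∀ k < m, projL τ'' k = projL τ k) ∧ (∀ k < m, projHI τ'' k = projHI τ' k)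

/-- `S` is limit closed: a trace belongs to `S` iff each of its finite prefixes is a
prefix of a trace of `S`. -/
def LimitClosed (S : Set (STrace LI HI LO HO)) : Prop :=
  ∀ τ : STrace LI HI LO HO, τ ∈ S ↔ ∀ k : ℕ, ∃ τ' ∈ S, ∀ n < k, τ' n = τ n

/-- Compactness for sequences over a finite alphabet: if `S` contains every sequence all of whose
finite prefixes extend to members of `S`, and each initial segment of a pointwise constraint `P`
is satisfied by some member of `S`, then some member of `S` satisfies `P` everywhere. -/
theorem exists_mem_forall_of_forall_prefix {α : Type*} [Finite α] {S : Set (ℕ → α)}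
    (hS : ∀ τ : ℕ → α, (∀ k : ℕ, ∃ τ' ∈ S, ∀ n < k, τ' n = τ n) → τ ∈ S)
    {P : ℕ → α → Prop} (hP : ∀ m : ℕ, ∃ τ ∈ S, ∀ k < m, P k (τ k)) :
    ∃ τ ∈ S, ∀ k, P k (τ k) := by
  choose f hfS hfP using hP
  have hlim : ∀ k, ∃ a, ∀ᶠ m in (Filter.hyperfilter ℕ : Filter ℕ), f m k = a := fun k => by
    obtain ⟨a, ha⟩ := ((Filter.hyperfilter ℕ).map fun m => f m k).eq_pure_of_finite
    have hmem : {a} ∈ (Filter.hyperfilter ℕ).map fun m => f m k := by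
      rw [ha]
      exact Set.mem_singleton a
    exact ⟨a, hmem⟩
  choose τ hτ using hlim
  refine ⟨τ, hS τ fun k => ?_, fun k => ?_⟩
  · obtain ⟨m, hm⟩ := ((Filter.eventually_all_finite (Set.finite_Iio k)).2 fun n _ => hτ n).exists
    exact ⟨f m, hfS m, hm⟩
  · have hgt : ∀ᶠ m in (Filter.hyperfilter ℕ : Filter ℕ), k < m :=
      Nat.hyperfilter_le_atTop (Filter.eventually_gt_atTop k)
    obtain ⟨m, hm, hkm⟩ := ((hτ k).and hgt).exists
    exact hm ▸ hfP m k hkm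

/-- a limit-closed synchronous trace system satisfies separability iff `H`
maintains synchronous secrecy with respect to `L` in `R(S)`, and satisfies generalized
noninterference iff `H` maintains synchronous `f_hi`-secrecy with respect to `L`. -/
theorem limitClosed_separability_iff_syncSecrecy
    [Fintype LI] [Fintype HI] [Fintype LO] [Fintype HO]
    [Nonempty LI] [Nonempty HI] [Nonempty LO] [Nonempty HO]
    (S : Set (STrace LI HI LO HO)) (hlc : LimitClosed S) :
    (Separability S ↔ SyncSecrecyHL S) ∧ (GeneralizedNI S ↔ SyncFhiSecrecy S) := by
  refine ⟨⟨fun h τ hτ τ' hτ' _ => ?_, fun h τ hτ τ' hτ' => ?_⟩,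
    ⟨fun h τ hτ τ' hτ' _ => ?_, fun h τ hτ τ' hτ' => ?_⟩⟩
  · obtain ⟨τ'', hS, hL, hH⟩ := h τ hτ τ' hτ'
    exact ⟨τ'', hS, fun k _ => congrFun hL k, fun k _ => congrFun hH k⟩
  · obtain ⟨τ'', hS, hτ''⟩ := exists_mem_forall_of_forall_prefix (fun τ => (hlc τ).2)
      (P := fun k a => (a.1, a.2.2.1) = projL τ k ∧ (a.2.1, a.2.2.2) = projH τ' k) fun m => by
        obtain ⟨σ, hσ, hL, hH⟩ := h τ hτ τ' hτ' m
        exact ⟨σ, hσ, fun k hk => ⟨hL k hk, hH k hk⟩⟩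
    exact ⟨τ'', hS, funext fun k => (hτ'' k).1, funext fun k => (hτ'' k).2⟩
  · obtain ⟨τ'', hS, hL, hH⟩ := h τ hτ τ' hτ'
    exact ⟨τ'', hS, fun k _ => congrFun hL k, fun k _ => congrFun hH k⟩
  · obtain ⟨τ'', hS, hτ''⟩ := exists_mem_forall_of_forall_prefix (fun τ => (hlc τ).2)
      (P := fun k a => (a.1, a.2.2.1) = projL τ k ∧ a.2.1 = projHI τ' k) fun m => by
        obtain ⟨σ, hσ, hL, hH⟩ := h τ hτ τ' hτ' m
        exact ⟨σ, hσ, fun k hk => ⟨hL k hk, hH k hk⟩⟩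
    exact ⟨τ'', hS, funext fun k => (hτ'' k).1, funext fun k => (hτ'' k).2⟩

end Paper
end

section
/- If Σ is an asynchronous trace system that is closed under interleavings, then Σ satisfies asynchronous separability if and only if H maintains total secrecy with respect to L in R(Σ), i.e., if and only if K_L(r,m) ∩ K_H(r',m') ≠ ∅ for all points (r,m) and (r',m') of R(Σ). -/
namespace Paper

variable {E : Type*}

/-- The low-event subsequence `τ|_L` of an asynchronous trace (`low e = true` iff `e` is
a low event). -/
def lowProj (low : E → Bool) (τ : List E) : List E := τ.filter low

/-- The high-event subsequence `τ|_H` of an asynchronous trace. -/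
def highProj (low : E → Bool) (τ : List E) : List E := τ.filter fun e => !low e

/-- An asynchronous trace system is closed under prefixes. -/
def PrefixClosed (S : Set (List E)) : Prop :=
  ∀ τ ∈ S, ∀ σ : List E, σ <+: τ → σ ∈ S

/-- `S` satisfies asynchronous separability: every interleaving of the low view of a
trace of `S` with the high view of a trace of `S` is a trace of `S`. -/
def AsyncSeparability (low : E → Bool) (S : Set (List E)) : Prop :=
  ∀ τ ∈ S, ∀ τ' ∈ S, ∀ τ'' : List E,
    lowProj low τ'' = lowProj low τ → highProj low τ'' = highProj low τ' → τ'' ∈ S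

/-- `S` is closed under interleavings. -/
def ClosedUnderInterleavings (low : E → Bool) (S : Set (List E)) : Prop :=
  ∀ τ ∈ S, ∀ τ' : List E,
    lowProj low τ' = lowProj low τ → highProj low τ' = highProj low τ → τ' ∈ S

/-- `T` is a run-like subset of `S`: any two of its elements are comparable under the
prefix order. -/
def RunLike (S T : Set (List E)) : Prop :=
  T ⊆ S ∧ ∀ τ ∈ T, ∀ σ ∈ T, τ <+: σ ∨ σ <+: τ

/-- `T` is a maximal run-like subset of `S`. -/
def MaximalRunLike (S T : Set (List E)) : Prop :=
  RunLike S T ∧ ∀ T' : Set (List E), RunLike S T' → T ⊆ T' → T' = T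

/-- `r` is the run determined by the maximal run-like set `T`: at each time `m`, `r m`
records the pair of the low view and the high view of the length-`m` trace of `T` if
there is one, and of the longest trace of `T` otherwise. -/
def IsRunOf (low : E → Bool) (T : Set (List E)) (r : ℕ → List E × List E) : Prop :=
  ∀ m : ℕ, ∃ τ ∈ T,
    (τ.length = m ∨ (τ.length < m ∧ ∀ σ ∈ T, σ.length ≤ τ.length)) ∧
    r m = (lowProj low τ, highProj low τ)

/-- The system `R(S)` of runs determined by the asynchronous trace system `S`. -/
def runsOfSystem (low : E → Bool) (S : Set (List E)) : Set (ℕ → List E × List E) :=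
  {r | ∃ T : Set (List E), MaximalRunLike S T ∧ IsRunOf low T r}

lemma MaximalRunLike.mem_of_prefix {S T : Set (List E)} (hpre : PrefixClosed S)
    (hT : MaximalRunLike S T) {τ σ : List E} (hτ : τ ∈ T) (hσ : σ <+: τ) : σ ∈ T := by
  have hcomp : ∀ ρ ∈ T, σ <+: ρ ∨ ρ <+: σ := by
    intro ρ hρ
    rcases hT.1.2 τ hτ ρ hρ with h | h
    · exact Or.inl (hσ.trans h)
    · exact List.prefix_or_prefix_of_prefix hσ h
  have hrun : RunLike S (insert σ T) := by
    refine ⟨Set.insert_subset (hpre τ (hT.1.1 hτ) σ hσ) hT.1.1, ?_⟩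
    rintro a (rfl | ha) b (rfl | hb)
    · exact Or.inl List.prefix_rfl
    · exact hcomp b hb
    · exact (hcomp a ha).symm
    · exact hT.1.2 a ha b hb
  rw [← hT.2 _ hrun (Set.subset_insert σ T)]
  exact Set.mem_insert σ T

lemma exists_maximalRunLike_mem {S : Set (List E)} {τ : List E} (hτ : τ ∈ S) :
    ∃ T, MaximalRunLike S T ∧ τ ∈ T := by
  obtain ⟨T, hτT, hT⟩ := zorn_subset_nonempty {T | RunLike S T} (by
    intro c hc hchain _
    refine ⟨⋃₀ c, ⟨Set.sUnion_subset fun t ht => (hc ht).1, ?_⟩,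
      fun s hs => Set.subset_sUnion_of_mem hs⟩
    rintro a ⟨s, hs, ha⟩ b ⟨t, ht, hb⟩
    rcases hchain.total hs ht with h | h
    · exact (hc ht).2 a (h ha) b hb
    · exact (hc hs).2 a ha b (h hb)) {τ} (by
    refine ⟨Set.singleton_subset_iff.2 hτ, ?_⟩
    rintro a rfl b rfl
    exact Or.inl List.prefix_rfl)
  exact ⟨T, ⟨hT.prop, fun T' hT' h => (hT.eq_of_subset hT' h).symm⟩, hτT rfl⟩

lemma MaximalRunLike.exists_isRunOf (low : E → Bool) {S T : Set (List E)}
    (hpre : PrefixClosed S) (hT : MaximalRunLike S T) (hne : T.Nonempty) :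
    ∃ r, IsRunOf low T r := by
  have key : ∀ m : ℕ, ∃ τ ∈ T,
      τ.length = m ∨ (τ.length < m ∧ ∀ σ ∈ T, σ.length ≤ τ.length) := by
    intro m
    by_cases h : ∃ ρ ∈ T, m ≤ ρ.length
    · obtain ⟨ρ, hρ, hm⟩ := h
      exact ⟨ρ.take m, hT.mem_of_prefix hpre hρ (List.take_prefix m ρ),
        Or.inl (List.length_take_of_le hm)⟩
    · push Not at h
      have hbdd : BddAbove (List.length '' T) :=
        ⟨m, by rintro _ ⟨ρ, hρ, rfl⟩; exact (h ρ hρ).le⟩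
      obtain ⟨τ, hτ, hlen⟩ := Nat.sSup_mem (hne.image List.length) hbdd
      exact ⟨τ, hτ, Or.inr ⟨h τ hτ, fun σ hσ =>
        hlen ▸ le_csSup hbdd (Set.mem_image_of_mem _ hσ)⟩⟩
  choose f hf hlen using key
  exact ⟨fun m => (lowProj low (f m), highProj low (f m)), fun m => ⟨f m, hf m, hlen m, rfl⟩⟩

lemma IsRunOf.apply_length {low : E → Bool} {S T : Set (List E)}
    {r : ℕ → List E × List E} (hr : IsRunOf low T r) (hT : RunLike S T) {τ : List E}
    (hτ : τ ∈ T) : r τ.length = (lowProj low τ, highProj low τ) := by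
  obtain ⟨σ, hσ, hlen | ⟨hlt, hmax⟩, hrσ⟩ := hr τ.length
  · have : σ = τ := by
      rcases hT.2 σ hσ τ hτ with h | h
      · exact h.eq_of_length hlen
      · exact (h.eq_of_length hlen.symm).symm
    rw [hrσ, this]
  · exact absurd (hmax τ hτ) hlt.not_ge

lemma exists_run_apply_length (low : E → Bool) {S : Set (List E)} (hpre : PrefixClosed S)
    {τ : List E} (hτ : τ ∈ S) :
    ∃ r ∈ runsOfSystem low S, r τ.length = (lowProj low τ, highProj low τ) := by
  obtain ⟨T, hT, hτT⟩ := exists_maximalRunLike_mem hτ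
  obtain ⟨r, hr⟩ := hT.exists_isRunOf low hpre ⟨τ, hτT⟩
  exact ⟨r, ⟨T, hT, hr⟩, hr.apply_length hT.1 hτT⟩

lemma exists_trace_of_mem_runsOfSystem {low : E → Bool} {S : Set (List E)}
    {r : ℕ → List E × List E} (hr : r ∈ runsOfSystem low S) (m : ℕ) :
    ∃ τ ∈ S, r m = (lowProj low τ, highProj low τ) := by
  obtain ⟨T, hT, hrT⟩ := hr
  obtain ⟨τ, hτ, -, h⟩ := hrT m
  exact ⟨τ, hT.1.1 hτ, h⟩

lemma lowProj_lowProj_append_highProj (low : E → Bool) (τ σ : List E) :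
    lowProj low (lowProj low τ ++ highProj low σ) = lowProj low τ := by
  simp [lowProj, highProj, List.filter_append, List.filter_filter]

lemma highProj_lowProj_append_highProj (low : E → Bool) (τ σ : List E) :
    highProj low (lowProj low τ ++ highProj low σ) = highProj low σ := by
  simp [lowProj, highProj, List.filter_append, List.filter_filter]

/-- if the asynchronous trace system `S` is closed under interleavings,
then `S` satisfies asynchronous separability iff `H` maintains total secrecy with
respect to `L` in `R(S)`, i.e. iff for all points `(r,m)` and `(r',m')` of `R(S)` there
is a point `(r'',m'')` at which `L` has the same local state as at `(r,m)` and `H` has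
the same local state as at `(r',m')`. -/
theorem asyncSeparability_iff_totalSecrecy (low : E → Bool) (S : Set (List E))
    (hpre : PrefixClosed S) (hint : ClosedUnderInterleavings low S) :
    AsyncSeparability low S ↔
      ∀ r ∈ runsOfSystem low S, ∀ r' ∈ runsOfSystem low S, ∀ m m' : ℕ,
        ∃ r'' ∈ runsOfSystem low S, ∃ m'' : ℕ,
          (r'' m'').1 = (r m).1 ∧ (r'' m'').2 = (r' m').2 := by
  constructor
  · intro hsep r hr r' hr' m m'
    obtain ⟨τ, hτ, hrτ⟩ := exists_trace_of_mem_runsOfSystem hr m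
    obtain ⟨σ, hσ, hrσ⟩ := exists_trace_of_mem_runsOfSystem hr' m'
    have hlow := lowProj_lowProj_append_highProj low τ σ
    have hhigh := highProj_lowProj_append_highProj low τ σ
    obtain ⟨r'', hr'', h⟩ :=
      exists_run_apply_length low hpre (hsep τ hτ σ hσ _ hlow hhigh)
    exact ⟨r'', hr'', _, by rw [h, hrτ, hlow], by rw [h, hrσ, hhigh]⟩
  · intro hsec τ hτ τ' hτ' τ'' hlow hhigh
    obtain ⟨r, hr, hrτ⟩ := exists_run_apply_length low hpre hτ
    obtain ⟨r', hr', hrτ'⟩ := exists_run_apply_length low hpre hτ'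
    obtain ⟨r'', hr'', m'', h₁, h₂⟩ := hsec r hr r' hr' τ.length τ'.length
    obtain ⟨σ, hσ, hrσ⟩ := exists_trace_of_mem_runsOfSystem hr'' m''
    rw [hrσ, hrτ] at h₁
    rw [hrσ, hrτ'] at h₂
    exact hint σ hσ τ'' (hlow.trans h₁.symm) (hhigh.trans h₂.symm)

end Paper
end
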